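/- arXiv:2410.11606 — 9 statements merged into one kernel-verified Lean document; each statement's English description precedes it below -/
import Mathlib

section
/- Let A be a commutative Noetherian ring, M a nonzero A-module, and p a prime ideal of A. Then Ass(M) = {p} if and only if the following two conditions hold: (1) for every a ∈ p and every m ∈ M there exists n ∈ ℕ with a^n · m = 0; (2) for every a ∉ p, the multiplication map M → M, m ↦ a·m, is injective. -/
/-- Let `A` be a commutative Noetherian ring, `M` a nonzero `A`-module and
`p` a prime ideal of `A`.  Then `Ass(M) = {p}` iff (1) every `a ∈ p` acts locally nilpotently
on `M`, and (2) multiplication by every `a ∉ p` is injective on `M`. -/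
theorem associatedPrimes_eq_singleton_iff
    {A : Type*} [CommRing A] [IsNoetherianRing A]
    {M : Type*} [AddCommGroup M] [Module A M] [Nontrivial M]
    (p : Ideal A) [p.IsPrime] :
    associatedPrimes A M = {p} ↔
      ((∀ a ∈ p, ∀ m : M, ∃ n : ℕ, a ^ n • m = 0) ∧
        (∀ a : A, a ∉ p → Function.Injective fun m : M => a • m)) := by
  constructor
  · intro h
    refine ⟨fun a ha m => ?_, fun a ha => ?_⟩
    · have hrad : a ∈ ((⊥ : Submodule A M).colon {m}).radical := by
        rw [← Ideal.sInf_minimalPrimes, Submodule.mem_sInf]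
        intro q hq
        have hass : q ∈ associatedPrimes A M :=
          isAssociatedPrime_iff.mpr
            ⟨hq.1.1, Submodule.exists_eq_colon_of_mem_minimalPrimes hq⟩
        rw [h, Set.mem_singleton_iff] at hass
        exact hass ▸ ha
      obtain ⟨n, hn⟩ := hrad
      exact ⟨n, by simpa [Submodule.mem_colon_singleton] using hn⟩
    · refine (injective_iff_map_eq_zero (DistribSMul.toAddMonoidHom M a)).mpr fun m hm => ?_
      by_contra hm0
      have hzd : a ∈ ⋃ q ∈ associatedPrimes A M, (q : Set A) := by
        rw [biUnion_associatedPrimes_eq_zero_divisors]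
        exact ⟨m, hm0, hm⟩
      rw [h, Set.biUnion_singleton] at hzd
      exact ha hzd
  · rintro ⟨hnil, hinj⟩
    refine (associatedPrimes.nonempty A M).subset_singleton_iff.mp fun q hq => ?_
    obtain ⟨hprime, x, hx⟩ := isAssociatedPrime_iff.mp hq
    have hmem (a : A) : a ∈ q ↔ a • x = 0 := by
      rw [hx, Submodule.mem_colon_singleton, Submodule.mem_bot]
    have hx0 : x ≠ 0 := fun h0 =>
      hprime.ne_top ((Ideal.eq_top_iff_one q).mpr ((hmem 1).mpr (by simp [h0])))
    rw [Set.mem_singleton_iff]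
    refine le_antisymm (fun a ha => ?_) fun a ha => ?_
    · by_contra hap
      exact hx0 (hinj a hap (by simpa using (hmem a).mp ha))
    · obtain ⟨n, hn⟩ := hnil a ha x
      exact hprime.mem_of_pow_mem n ((hmem _).mpr hn)
end

section
/- If A is a commutative Noetherian ring, then there is no infinite strictly decreasing sequence p_1 ⊋ p_2 ⊋ p_3 ⊋ ⋯ of prime ideals of A; equivalently, the strict inclusion relation on the set of prime ideals of A is well-founded. -/
/-- If `A` is a commutative Noetherian ring, then there is no infinite
strictly decreasing sequence of prime ideals of `A`; equivalently, strict inclusion on the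
set of prime ideals of `A` is well-founded. -/
theorem wellFounded_lt_primes_of_isNoetherianRing
    (A : Type*) [CommRing A] [IsNoetherianRing A] :
    (¬ ∃ f : ℕ → Ideal A, (∀ n, (f n).IsPrime) ∧ ∀ n, f (n + 1) < f n) ∧
      WellFounded (fun p q : {I : Ideal A // I.IsPrime} => (p : Ideal A) < (q : Ideal A)) := by
  have wf : WellFounded
      (fun p q : {I : Ideal A // I.IsPrime} => (p : Ideal A) < (q : Ideal A)) := by
    refine Subrelation.wf ?_
      (InvImage.wf (fun p : {I : Ideal A // I.IsPrime} => (p : Ideal A).height) wellFounded_lt)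
    intro p q hpq
    have := p.2
    exact Ideal.height_strict_mono_of_isPrime hpq
  refine ⟨?_, wf⟩
  rintro ⟨f, hf, hlt⟩
  obtain ⟨_, ⟨k, rfl⟩, hmin⟩ := wf.has_min (Set.range fun n => (⟨f n, hf n⟩ : {I : Ideal A // I.IsPrime}))
    (Set.range_nonempty _)
  exact hmin _ ⟨k + 1, rfl⟩ (hlt k)
end

section
/- Let A be a commutative Noetherian ring, M an A-module, and p an associated prime of M that is minimal in Ass(M), i.e. no q ∈ Ass(M) satisfies q ⊊ p. Let G be a submodule of M. Then G = ker(M → M_p) (the kernel of the canonical localization map at p) if and only if both Ass(M/G) = {p} and Ass(G) = Ass(M) \ {p} hold. -/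
section

variable {A : Type*} [CommRing A] [IsNoetherianRing A] {M : Type*} [AddCommGroup M] [Module A M]

/-- An element that survives in the localization at `p` has a minimal prime of its annihilator
below `p`, and this prime is associated to the module. -/
theorem exists_mem_associatedPrimes_le_of_notMem_ker (p : Ideal A) [p.IsPrime] {x : M}
    (hx : x ∉ LinearMap.ker (LocalizedModule.mkLinearMap p.primeCompl M)) :
    ∃ q ∈ associatedPrimes A M,
      q ∈ ((⊥ : Submodule A M).colon {x}).minimalPrimes ∧ q ≤ p := by
  have hle : (⊥ : Submodule A M).colon {x} ≤ p := by
    intro s hs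
    by_contra hsp
    rw [Submodule.mem_colon_singleton, Submodule.mem_bot] at hs
    exact hx (LocalizedModule.mem_ker_mkLinearMap_iff.2 ⟨s, hsp, hs⟩)
  obtain ⟨q, hq, hqp⟩ := Ideal.exists_minimalPrimes_le hle
  exact ⟨q, isAssociatedPrime_iff.2
    ⟨hq.1.1, Submodule.exists_eq_colon_of_mem_minimalPrimes hq⟩, hq, hqp⟩

theorem not_le_of_mem_associatedPrimes_ker (p : Ideal A) [p.IsPrime] {q : Ideal A}
    (hq : q ∈ associatedPrimes A
      (LinearMap.ker (LocalizedModule.mkLinearMap p.primeCompl M))) : ¬ q ≤ p := by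
  obtain ⟨-, ⟨x, hx⟩, rfl⟩ := isAssociatedPrime_iff.1 hq
  obtain ⟨s, hs, hsx⟩ := LocalizedModule.mem_ker_mkLinearMap_iff.1 hx
  intro hle
  refine hs (hle ?_)
  rw [Submodule.mem_colon_singleton, Submodule.mem_bot]
  exact Subtype.ext hsx

/-- If `p` is minimal in `Ass(M)`, then `M / ker (M → M_p)` has no associated prime besides `p`. -/
theorem associatedPrimes_quotient_ker_subset (p : Ideal A) [p.IsPrime]
    (hmin : ∀ q ∈ associatedPrimes A M, ¬ q < p) :
    associatedPrimes A (M ⧸ LinearMap.ker (LocalizedModule.mkLinearMap p.primeCompl M)) ⊆ {p} := by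
  intro q hq
  obtain ⟨hqprime, y, hy⟩ := isAssociatedPrime_iff.1 hq
  obtain ⟨x, rfl⟩ := Submodule.mkQ_surjective _ y
  have mem_q (r : A) :
      r ∈ q ↔ r • x ∈ LinearMap.ker (LocalizedModule.mkLinearMap p.primeCompl M) := by
    rw [hy, Submodule.mem_colon_singleton, Submodule.mem_bot, ← map_smul, ← LinearMap.mem_ker,
      Submodule.ker_mkQ]
  have hx : x ∉ LinearMap.ker (LocalizedModule.mkLinearMap p.primeCompl M) := by
    intro hx
    exact hqprime.ne_top ((Ideal.eq_top_iff_one q).2 ((mem_q 1).2 (by rwa [one_smul])))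
  have hqp : q ≤ p := by
    intro r hr
    by_contra hrp
    obtain ⟨t, ht, h⟩ := LocalizedModule.mem_ker_mkLinearMap_iff.1 ((mem_q r).1 hr)
    exact hx (LocalizedModule.mem_ker_mkLinearMap_iff.2
      ⟨t * r, p.primeCompl.mul_mem ht hrp, by rw [mul_smul, h]⟩)
  obtain ⟨q', hq', hq'min, hq'p⟩ := exists_mem_associatedPrimes_le_of_notMem_ker p hx
  obtain rfl : q' = p := eq_of_le_of_not_lt hq'p (hmin q' hq')
  refine le_antisymm hqp (hq'min.2 ⟨hqprime, fun r hr ↦ (mem_q r).2 ?_⟩ hqp)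
  rw [Submodule.mem_colon_singleton, Submodule.mem_bot] at hr
  rw [hr]
  exact zero_mem _

theorem le_ker_of_forall_associatedPrimes_not_le (p : Ideal A) [p.IsPrime] (G : Submodule A M)
    (h : ∀ q ∈ associatedPrimes A G, ¬ q ≤ p) :
    G ≤ LinearMap.ker (LocalizedModule.mkLinearMap p.primeCompl M) := by
  intro x hxG
  by_contra hx
  obtain ⟨q, hq, -, hqp⟩ := exists_mem_associatedPrimes_le_of_notMem_ker (M := G) p (x := ⟨x, hxG⟩)
    fun hx' ↦ by
      obtain ⟨s, hs, hsx⟩ := LocalizedModule.mem_ker_mkLinearMap_iff.1 hx'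
      exact hx (LocalizedModule.mem_ker_mkLinearMap_iff.2 ⟨s, hs, congrArg Subtype.val hsx⟩)
  exact h q hq hqp

theorem ker_le_of_associatedPrimes_quotient_subset (p : Ideal A) [p.IsPrime] (G : Submodule A M)
    (h : associatedPrimes A (M ⧸ G) ⊆ {p}) :
    LinearMap.ker (LocalizedModule.mkLinearMap p.primeCompl M) ≤ G := by
  intro x hx
  obtain ⟨s, hs, hsx⟩ := LocalizedModule.mem_ker_mkLinearMap_iff.1 hx
  by_contra hxG
  obtain ⟨q, hq, hle⟩ := exists_le_isAssociatedPrime_of_isNoetherianRing A (G.mkQ x)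
    fun h0 ↦ hxG ((Submodule.Quotient.mk_eq_zero G).1 h0)
  obtain rfl : q = p := h hq
  refine hs (hle ?_)
  rw [Submodule.mem_colon_singleton, Submodule.mem_bot, ← map_smul, hsx, map_zero]

end

/-- Let `A` be a commutative Noetherian ring, `M` an `A`-module and `p` an
associated prime of `M` that is minimal in `Ass(M)`.  Let `G` be a submodule of `M`.  Then
`G = ker (M → M_p)` iff `Ass(M/G) = {p}` and `Ass(G) = Ass(M) \ {p}`. -/
theorem eq_ker_localization_iff
    {A : Type*} [CommRing A] [IsNoetherianRing A]
    {M : Type*} [AddCommGroup M] [Module A M]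
    (p : Ideal A) [p.IsPrime] (hp : p ∈ associatedPrimes A M)
    (hmin : ∀ q ∈ associatedPrimes A M, ¬ q < p)
    (G : Submodule A M) :
    G = LinearMap.ker (LocalizedModule.mkLinearMap p.primeCompl M) ↔
      (associatedPrimes A (M ⧸ G) = {p} ∧
        associatedPrimes A G = associatedPrimes A M \ {p}) := by
  constructor
  · rintro rfl
    have hpK : p ∉ associatedPrimes A
        (LinearMap.ker (LocalizedModule.mkLinearMap p.primeCompl M)) :=
      fun h ↦ not_le_of_mem_associatedPrimes_ker p h le_rfl
    have hunion := associatedPrimes.subset_union_of_exact (R := A)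
      (LinearMap.ker (LocalizedModule.mkLinearMap p.primeCompl M)).injective_subtype
      (LinearMap.exact_subtype_mkQ _)
    have hquot := associatedPrimes_quotient_ker_subset p hmin
    refine ⟨hquot.antisymm (Set.singleton_subset_iff.2 ((hunion hp).resolve_left hpK)),
      Set.Subset.antisymm (fun q hq ↦ ⟨?_, ?_⟩) fun q hq ↦ ?_⟩
    · exact associatedPrimes.subset_of_injective (Submodule.injective_subtype _) hq
    · rintro rfl
      exact hpK hq
    · exact (hunion hq.1).resolve_right fun h ↦ hq.2 (hquot h)
  · rintro ⟨hquot, hsub⟩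
    refine le_antisymm (le_ker_of_forall_associatedPrimes_not_le p G fun q hq hqp ↦ ?_)
      (ker_le_of_associatedPrimes_quotient_subset p G hquot.subset)
    rw [hsub] at hq
    exact hmin q hq.1 (lt_of_le_of_ne hqp hq.2)
end

section
/- Let A be a commutative Noetherian ring and M a nonzero A-module. Suppose Ass(M) is equipped with a linear order < that is a well-order (every nonempty subset has a least element) and extends strict inclusion, i.e. q ⊊ p implies q < p for q, p ∈ Ass(M). For t ∈ Ass(M) that is not the greatest element, let succ(t) denote the least element of {s ∈ Ass(M) : t < s}; call t a limit point if t is neither the least element of Ass(M) nor of the form succ(s) for some s. Then there exists a unique family (M^t)_{t ∈ Ass(M)} of submodules of M such that: (a) M^s ⊊ M^r whenever r < s; (b) M^{t_0} = M, where t_0 is the least element of Ass(M); (c) Ass(M^t / M^{succ(t)}) = {t} for every t that is not the greatest element; (d) M^t = ⋂_{r < t} M^r for every limit point t; (e) Ass(M^t) = {r ∈ Ass(M) : t ≤ r} for every t. Moreover, this unique family satisfies: M^{succ(t)} = ker(M^t → (M^t)_t) (the kernel of the canonical localization map of the module M^t at the prime ideal t) for every non-greatest t; if Ass(M) has a greatest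 element t, then Ass(M^t) = {t}; and if Ass(M) has no greatest element, then ⋂_{t ∈ Ass(M)} M^t = 0. -/
section

variable {A : Type*} [CommRing A] {M : Type*} [AddCommGroup M] [Module A M]

/-- `s` is the successor of `t` for the order `lt`: `s` is the least element of
`{u | lt t u}`. -/
def IsSuccFor {α : Type*} (lt : α → α → Prop) (t s : α) : Prop :=
  lt t s ∧ ∀ u, lt t u → ¬ lt u s

/-- `t` is a limit point for the order `lt`: it is neither the least element nor the
successor of any element. -/
def IsLimitFor {α : Type*} (lt : α → α → Prop) (t : α) : Prop :=
  (∃ s, lt s t) ∧ ∀ s, ¬ IsSuccFor lt s t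

/-- The conditions (a)–(e) on a filtration `(M^t)_{t ∈ Ass(M)}` indexed by the associated
primes of `M`, well-ordered by `lt`:
(a) `M^s ⊊ M^r` whenever `r < s`;
(b) `M^{t₀} = M` for the least element `t₀`;
(c) `Ass(M^t / M^{succ t}) = {t}` whenever `t` is not the greatest element;
(d) `M^t = ⋂_{r < t} M^r` for every limit point `t`;
(e) `Ass(M^t) = {r ∈ Ass(M) : t ≤ r}` for every `t`. -/
def IsCoprimaryFamily (lt : ↥(associatedPrimes A M) → ↥(associatedPrimes A M) → Prop)
    (F : ↥(associatedPrimes A M) → Submodule A M) : Prop :=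
  (∀ r s, lt r s → F s < F r) ∧
  (∀ t, (∀ s, ¬ lt s t) → F t = ⊤) ∧
  (∀ t s, IsSuccFor lt t s →
    associatedPrimes A (↥(F t) ⧸ Submodule.comap (F t).subtype (F s)) = {(t : Ideal A)}) ∧
  (∀ t, IsLimitFor lt t → F t = ⨅ r : {r // lt r t}, F r.1) ∧
  (∀ t, associatedPrimes A ↥(F t) = Subtype.val '' {r | t = r ∨ lt t r})

theorem IsSuccFor.lt_iff {α : Type*} {lt : α → α → Prop} [IsWellOrder α lt] {t s r : α}
    (h : IsSuccFor lt t s) :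
    lt r s ↔ r = t ∨ lt r t := by
  refine ⟨fun hr ↦ ?_, ?_⟩
  · rcases trichotomous_of lt r t with hrt | hrt | hrt
    · exact .inr hrt
    · exact .inl hrt
    · exact absurd hr (h.2 r hrt)
  · rintro (rfl | hr)
    · exact h.1
    · exact trans_of lt hr h.1

theorem IsLimitFor.exists_between {α : Type*} {lt : α → α → Prop} {t r : α} (h : IsLimitFor lt t)
    (hr : lt r t) : ∃ s, lt r s ∧ lt s t := by
  have := h.2 r
  simp only [IsSuccFor, not_and, not_forall, not_not] at this
  obtain ⟨s, hrs, hst⟩ := this hr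
  exact ⟨s, hrs, hst⟩

/-- The submodule of elements of `M` that vanish in `M_r` for every `r` preceding `t`. -/
noncomputable def vanishingBelow (lt : ↥(associatedPrimes A M) → ↥(associatedPrimes A M) → Prop)
    (t : ↥(associatedPrimes A M)) : Submodule A M :=
  ⨅ r : {r // lt r t}, LinearMap.ker (LocalizedModule.mkLinearMap r.1.1.primeCompl M)

theorem mem_vanishingBelow {lt : ↥(associatedPrimes A M) → ↥(associatedPrimes A M) → Prop}
    {t : ↥(associatedPrimes A M)} {x : M} :
    x ∈ vanishingBelow lt t ↔ ∀ r, lt r t → ∃ u ∉ r.1, u • x = 0 := by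
  simp only [vanishingBelow, Submodule.mem_iInf, Subtype.forall,
    LocalizedModule.mem_ker_mkLinearMap_iff]
  rfl

theorem mem_associatedPrimes_submodule_iff [IsNoetherianRing A] {N : Submodule A M}
    {p : Ideal A} :
    p ∈ associatedPrimes A N ↔ p.IsPrime ∧ ∃ x ∈ N, ∀ a, a ∈ p ↔ a • x = 0 := by
  simp [AssociatedPrimes.mem_iff, isAssociatedPrime_iff, SetLike.ext_iff,
    Submodule.mem_colon_singleton, ← Submodule.coe_eq_zero]

theorem mem_associatedPrimes_subquotient_iff [IsNoetherianRing A] {N L : Submodule A M}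
    {p : Ideal A} :
    p ∈ associatedPrimes A (N ⧸ Submodule.comap N.subtype L) ↔
      p.IsPrime ∧ ∃ x ∈ N, ∀ a, a ∈ p ↔ a • x ∈ L := by
  rw [AssociatedPrimes.mem_iff, isAssociatedPrime_iff]
  refine and_congr_right fun _ ↦
    (Submodule.mkQ_surjective (Submodule.comap N.subtype L)).exists.trans ?_
  simp [SetLike.ext_iff, Submodule.mem_colon_singleton, ← Submodule.Quotient.mk_smul]

theorem mem_map_ker_localization_iff {N : Submodule A M} {p : Ideal A} (hp : p.IsPrime) {x : M} :
    x ∈ Submodule.map N.subtype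
        (LinearMap.ker (LocalizedModule.mkLinearMap (@Ideal.primeCompl A _ p hp) N)) ↔
      x ∈ N ∧ ∃ u ∉ p, u • x = 0 := by
  simp only [Submodule.mem_map, LocalizedModule.mem_ker_mkLinearMap_iff, Subtype.exists,
    Submodule.subtype_apply, exists_and_right, exists_eq_right]
  exact ⟨fun ⟨h, u, hu, hux⟩ ↦ ⟨h, u, hu, congrArg Subtype.val hux⟩,
    fun ⟨h, u, hu, hux⟩ ↦ ⟨h, u, hu, Subtype.ext hux⟩⟩

/-- An element of `N` vanishes in `N_p` if no associated prime of `N` is contained in `p`. -/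
theorem exists_smul_eq_zero_of_forall_associatedPrimes [IsNoetherianRing A] {N : Submodule A M}
    {p : Ideal A} [p.IsPrime] (h : ∀ q ∈ associatedPrimes A N, ¬ q ≤ p) {x : M} (hx : x ∈ N) :
    ∃ u ∉ p, u • x = 0 := by
  by_contra! hu
  have hle : Submodule.colon (⊥ : Submodule A N) {⟨x, hx⟩} ≤ p := fun a ha ↦ by
    by_contra hap
    rw [Submodule.mem_colon_singleton, Submodule.mem_bot] at ha
    exact hu a hap (congrArg Subtype.val ha)
  obtain ⟨q, hq, hqp⟩ := Ideal.exists_minimalPrimes_le hle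
  obtain ⟨y, hy⟩ := Submodule.exists_eq_colon_of_mem_minimalPrimes hq
  exact h q (isAssociatedPrime_iff.mpr ⟨hq.1.1, y, hy⟩) hqp

section WellOrder

variable {lt : ↥(associatedPrimes A M) → ↥(associatedPrimes A M) → Prop}
  [IsWellOrder ↥(associatedPrimes A M) lt]

theorem not_le_of_lt_of_extends
    (hext : ∀ p q : ↥(associatedPrimes A M), (p : Ideal A) < (q : Ideal A) → lt p q)
    {r t : ↥(associatedPrimes A M)} (hrt : lt r t) : ¬ t.1 ≤ r.1 := by
  intro hle
  rcases hle.eq_or_lt with h | h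
  · exact irrefl_of lt r ((Subtype.ext h : t = r) ▸ hrt)
  · exact asymm_of lt hrt (hext _ _ h)

theorem associatedPrimes_vanishingBelow [IsNoetherianRing A]
    (hext : ∀ p q : ↥(associatedPrimes A M), (p : Ideal A) < (q : Ideal A) → lt p q)
    (t : ↥(associatedPrimes A M)) :
    associatedPrimes A (vanishingBelow lt t) = Subtype.val '' {r | t = r ∨ lt t r} := by
  ext p
  constructor
  · intro hp
    have hpM : p ∈ associatedPrimes A M :=
      associatedPrimes.subset_of_injective (vanishingBelow lt t).injective_subtype hp
    refine ⟨⟨p, hpM⟩, ?_, rfl⟩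
    obtain ⟨-, x, hx, hpx⟩ := mem_associatedPrimes_submodule_iff.mp hp
    rcases trichotomous_of lt t ⟨p, hpM⟩ with h | h | h
    · exact .inr h
    · exact .inl h
    · obtain ⟨u, hu, hux⟩ := mem_vanishingBelow.mp hx _ h
      exact absurd ((hpx u).mpr hux) hu
  · rintro ⟨p, hp, rfl⟩
    obtain ⟨hprime, x, hx⟩ := isAssociatedPrime_iff.mp p.2
    have hpx (a : A) : a ∈ p.1 ↔ a • x = 0 := by
      rw [hx, Submodule.mem_colon_singleton, Submodule.mem_bot]
    refine mem_associatedPrimes_submodule_iff.mpr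
      ⟨hprime, x, mem_vanishingBelow.mpr fun r hr ↦ ?_, hpx⟩
    have hrp : lt r p := by
      rcases hp with rfl | hp
      · exact hr
      · exact trans_of lt hr hp
    obtain ⟨u, hu, hur⟩ := SetLike.not_le_iff_exists.mp (not_le_of_lt_of_extends hext hrp)
    exact ⟨u, hur, (hpx u).mp hu⟩

theorem mem_vanishingBelow_succ {t s : ↥(associatedPrimes A M)} (h : IsSuccFor lt t s) {x : M} :
    x ∈ vanishingBelow lt s ↔ x ∈ vanishingBelow lt t ∧ ∃ u ∉ t.1, u • x = 0 := by
  simp only [mem_vanishingBelow, h.lt_iff, or_imp, forall_and, forall_eq, and_comm]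

theorem associatedPrimes_vanishingBelow_succ [IsNoetherianRing A]
    (hext : ∀ p q : ↥(associatedPrimes A M), (p : Ideal A) < (q : Ideal A) → lt p q)
    {t s : ↥(associatedPrimes A M)} (h : IsSuccFor lt t s) :
    associatedPrimes A (↥(vanishingBelow lt t) ⧸
      Submodule.comap (vanishingBelow lt t).subtype (vanishingBelow lt s)) = {(t : Ideal A)} := by
  ext p
  rw [mem_associatedPrimes_subquotient_iff, Set.mem_singleton_iff]
  constructor
  · rintro ⟨hprime, x, hx, hpx⟩
    have hpt : p ≤ t.1 := fun a ha ↦ by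
      by_contra hat
      obtain ⟨-, u, hu, hux⟩ := (mem_vanishingBelow_succ h).mp ((hpx a).mp ha)
      refine hprime.ne_top ((Ideal.eq_top_iff_one p).mpr ((hpx 1).mpr ?_))
      rw [one_smul]
      refine (mem_vanishingBelow_succ h).mpr ⟨hx, u * a, ?_, by rw [mul_smul, hux]⟩
      exact fun hua ↦ (t.2.isPrime.mem_or_mem hua).elim hu hat
    obtain ⟨S, hS⟩ := (isNoetherianRing_iff_ideal_fg A).mp ‹_› p
    have hker (a : S) : ∃ u : t.1.primeCompl, (u : A) • (a : A) • x = 0 := by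
      have ha : (a : A) ∈ p := hS ▸ Ideal.subset_span a.2
      obtain ⟨-, u, hu, hux⟩ := (mem_vanishingBelow_succ h).mp ((hpx a).mp ha)
      exact ⟨⟨u, hu⟩, hux⟩
    choose u hu using hker
    have hprod :
        p ≤ Submodule.colon (⊥ : Submodule A M) {((∏ a, u a : t.1.primeCompl) : A) • x} := by
      rw [← hS, Ideal.span_le]
      intro a ha
      obtain ⟨v, hv⟩ := Finset.dvd_prod_of_mem u (Finset.mem_univ ⟨a, ha⟩)
      have := hu ⟨a, ha⟩
      rw [SetLike.mem_coe, Submodule.mem_colon_singleton, Submodule.mem_bot, hv,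
        Submonoid.coe_mul, smul_smul,
        show a * ((u ⟨a, ha⟩ : A) * v) = v * ((u ⟨a, ha⟩ : A) * a) by ring, mul_smul, mul_smul,
        this, smul_zero]
    set w : t.1.primeCompl := ∏ a, u a
    have hpass : p ∈ associatedPrimes A (vanishingBelow lt t) := by
      refine mem_associatedPrimes_submodule_iff.mpr
        ⟨hprime, (w : A) • x, Submodule.smul_mem _ _ hx, fun a ↦ ⟨fun ha ↦ ?_, fun ha ↦ ?_⟩⟩
      · simpa [Submodule.mem_colon_singleton] using hprod ha
      · have : a * w ∈ p := (hpx _).mpr (by rw [mul_smul, ha]; exact zero_mem _)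
        exact (hprime.mem_or_mem this).resolve_right fun hw ↦ w.2 (hpt hw)
    rw [associatedPrimes_vanishingBelow hext] at hpass
    obtain ⟨q, hq, rfl⟩ := hpass
    rcases hq with rfl | hq
    · rfl
    · exact absurd hpt (not_le_of_lt_of_extends hext hq)
  · rintro rfl
    have ht : t.1 ∈ associatedPrimes A (vanishingBelow lt t) := by
      rw [associatedPrimes_vanishingBelow hext]
      exact ⟨t, .inl rfl, rfl⟩
    obtain ⟨hprime, x, hx, htx⟩ := mem_associatedPrimes_submodule_iff.mp ht
    refine ⟨hprime, x, hx, fun a ↦ ⟨fun ha ↦ ?_, fun ha ↦ ?_⟩⟩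
    · rw [(htx a).mp ha]
      exact zero_mem _
    · obtain ⟨-, u, hu, hux⟩ := (mem_vanishingBelow_succ h).mp ha
      rw [← mul_smul, ← htx] at hux
      exact (hprime.mem_or_mem hux).resolve_left hu

theorem isCoprimaryFamily_vanishingBelow [IsNoetherianRing A]
    (hext : ∀ p q : ↥(associatedPrimes A M), (p : Ideal A) < (q : Ideal A) → lt p q) :
    IsCoprimaryFamily lt (vanishingBelow lt) := by
  refine ⟨fun r s hrs ↦ ?_, fun t ht ↦ ?_, fun t s h ↦ associatedPrimes_vanishingBelow_succ hext h,
    fun t ht ↦ ?_, associatedPrimes_vanishingBelow hext⟩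
  · refine lt_of_le_of_ne (fun x hx ↦ ?_) fun heq ↦ ?_
    · rw [mem_vanishingBelow] at hx ⊢
      exact fun q hq ↦ hx q (trans_of lt hq hrs)
    · have hr : r.1 ∈ associatedPrimes A (vanishingBelow lt s) := by
        rw [heq, associatedPrimes_vanishingBelow hext]
        exact ⟨r, .inl rfl, rfl⟩
      rw [associatedPrimes_vanishingBelow hext] at hr
      obtain ⟨q, hq, hqr⟩ := hr
      obtain rfl := Subtype.ext hqr
      rcases hq with rfl | hq
      · exact irrefl_of lt _ hrs
      · exact asymm_of lt hq hrs
  · exact eq_top_iff.mpr fun x _ ↦ mem_vanishingBelow.mpr fun r hr ↦ absurd hr (ht r)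
  · ext x
    simp only [Submodule.mem_iInf, mem_vanishingBelow]
    refine ⟨fun hx s r hr ↦ hx r (trans_of lt hr s.2), fun hx r hr ↦ ?_⟩
    obtain ⟨s, hrs, hst⟩ := ht.exists_between hr
    exact hx ⟨s, hst⟩ r hrs

theorem IsCoprimaryFamily.mem_succ_iff [IsNoetherianRing A]
    (hext : ∀ p q : ↥(associatedPrimes A M), (p : Ideal A) < (q : Ideal A) → lt p q)
    {F : ↥(associatedPrimes A M) → Submodule A M} (hF : IsCoprimaryFamily lt F)
    {t s : ↥(associatedPrimes A M)} (h : IsSuccFor lt t s) {x : M} :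
    x ∈ F s ↔ x ∈ F t ∧ ∃ u ∉ t.1, u • x = 0 := by
  obtain ⟨hanti, -, hsucc, -, hass⟩ := hF
  refine ⟨fun hx ↦ ⟨(hanti t s h.1).le hx, ?_⟩, fun ⟨hx, u, hu, hux⟩ ↦ ?_⟩
  · refine exists_smul_eq_zero_of_forall_associatedPrimes (fun q hq ↦ ?_) hx
    rw [hass] at hq
    obtain ⟨q, hq, rfl⟩ := hq
    refine not_le_of_lt_of_extends hext ?_
    rcases hq with rfl | hq
    · exact h.1
    · exact trans_of lt h.1 hq
  · by_contra hxs
    have hne : (Submodule.comap (F t).subtype (F s)).mkQ ⟨x, hx⟩ ≠ 0 := by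
      simpa using hxs
    obtain ⟨p, hp, hle⟩ := exists_le_isAssociatedPrime_of_isNoetherianRing A _ hne
    have hpt : p = t.1 := by
      have : p ∈ associatedPrimes A (↥(F t) ⧸ Submodule.comap (F t).subtype (F s)) := hp
      rwa [hsucc t s h] at this
    refine hu (hpt ▸ hle ?_)
    rw [Submodule.mem_colon_singleton, Submodule.mem_bot, ← map_smul,
      show u • (⟨x, hx⟩ : F t) = 0 from Subtype.ext hux, map_zero]

theorem IsCoprimaryFamily.unique [IsNoetherianRing A]
    (hext : ∀ p q : ↥(associatedPrimes A M), (p : Ideal A) < (q : Ideal A) → lt p q)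
    {F G : ↥(associatedPrimes A M) → Submodule A M} (hF : IsCoprimaryFamily lt F)
    (hG : IsCoprimaryFamily lt G) : F = G := by
  funext t
  induction t using (IsWellFounded.wf (r := lt)).induction with
  | _ t ih =>
  by_cases hmin : ∃ s, lt s t
  · by_cases hlim : ∀ s, ¬ IsSuccFor lt s t
    · rw [hF.2.2.2.1 t ⟨hmin, hlim⟩, hG.2.2.2.1 t ⟨hmin, hlim⟩]
      exact iInf_congr fun r ↦ ih r.1 r.2
    · push Not at hlim
      obtain ⟨s, hs⟩ := hlim
      ext x
      rw [hF.mem_succ_iff hext hs, hG.mem_succ_iff hext hs, ih s hs.1]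
  · push Not at hmin
    rw [hF.2.1 t hmin, hG.2.1 t hmin]

theorem IsCoprimaryFamily.iInf_eq_bot [IsNoetherianRing A]
    {F : ↥(associatedPrimes A M) → Submodule A M} (hF : IsCoprimaryFamily lt F)
    (hmax : ∀ t, ∃ s, lt t s) : ⨅ t, F t = ⊥ := by
  by_contra hne
  have := Submodule.nontrivial_iff_ne_bot.mpr hne
  obtain ⟨p, hp⟩ := associatedPrimes.nonempty A ↥(⨅ t, F t)
  have hpM : p ∈ associatedPrimes A M :=
    associatedPrimes.subset_of_injective (⨅ t, F t).injective_subtype hp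
  obtain ⟨s, hs⟩ := hmax ⟨p, hpM⟩
  have hps : p ∈ associatedPrimes A (F s) :=
    associatedPrimes.subset_of_injective (Submodule.inclusion_injective (iInf_le F s)) hp
  rw [hF.2.2.2.2 s] at hps
  obtain ⟨q, hq, rfl⟩ := hps
  rcases hq with rfl | hq
  · exact irrefl_of lt _ hs
  · exact asymm_of lt hs hq

end WellOrder

/-- Let `A` be a commutative Noetherian ring and `M` a nonzero `A`-module,
and let `lt` be a well-order on `Ass(M)` extending strict inclusion.  Then there is a unique
family `(M^t)_{t ∈ Ass(M)}` of submodules satisfying conditions (a)–(e); moreover this family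
satisfies `M^{succ t} = ker (M^t → (M^t)_t)` for every non-greatest `t`, `Ass(M^t) = {t}` if
`t` is the greatest element, and `⋂_t M^t = 0` if there is no greatest element. -/
theorem exists_unique_coprimary_family [IsNoetherianRing A] [Nontrivial M]
    (lt : ↥(associatedPrimes A M) → ↥(associatedPrimes A M) → Prop)
    [IsWellOrder ↥(associatedPrimes A M) lt]
    (hext : ∀ p q : ↥(associatedPrimes A M), (p : Ideal A) < (q : Ideal A) → lt p q) :
    (∃! F : ↥(associatedPrimes A M) → Submodule A M, IsCoprimaryFamily lt F) ∧
    ∀ F : ↥(associatedPrimes A M) → Submodule A M, IsCoprimaryFamily lt F →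
      ((∀ t s, IsSuccFor lt t s →
          F s = Submodule.map (F t).subtype
            (LinearMap.ker (LocalizedModule.mkLinearMap
              (@Ideal.primeCompl A _ (t : Ideal A) (IsAssociatedPrime.isPrime t.2))
              ↥(F t)))) ∧
        (∀ t, (∀ s, ¬ lt t s) → associatedPrimes A ↥(F t) = {(t : Ideal A)}) ∧
        ((∀ t, ∃ s, lt t s) → (⨅ t, F t) = ⊥)) := by
  refine ⟨⟨vanishingBelow lt, isCoprimaryFamily_vanishingBelow hext,
    fun G hG ↦ hG.unique hext (isCoprimaryFamily_vanishingBelow hext)⟩,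
    fun F hF ↦ ⟨fun t s h ↦ ?_, fun t ht ↦ ?_, hF.iInf_eq_bot⟩⟩
  · ext x
    rw [mem_map_ker_localization_iff, hF.mem_succ_iff hext h]
  · rw [hF.2.2.2.2 t, show {r | t = r ∨ lt t r} = {t} by ext r; simp [ht, eq_comm],
      Set.image_singleton]
end
end

section
/- Let A be a commutative Noetherian ring, M a nonzero finitely generated A-module, and p, q two distinct associated primes of M that are both minimal in Ass(M) (no element of Ass(M) is strictly contained in p or in q). Set G = ker(M → M_p) and H = ker(M → M_q), the kernels of the canonical localization maps of M at p and at q. Then G ∩ H = ker(G → G_q) = ker(H → H_p), where ker(G → G_q) denotes the kernel of the canonical localization map of the module G at q, regarded as a submodule of M, and similarly for ker(H → H_p). -/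
/-- The kernel of the localization map of a submodule `N` of `M`, viewed inside `M`, is the
intersection of `N` with the kernel of the localization map of `M`. -/
theorem Submodule.map_subtype_ker_mkLinearMap {A M : Type*} [CommRing A] [AddCommGroup M]
    [Module A M] (S : Submonoid A) (N : Submodule A M) :
    Submodule.map N.subtype (LinearMap.ker (LocalizedModule.mkLinearMap S N)) =
      N ⊓ LinearMap.ker (LocalizedModule.mkLinearMap S M) := by
  ext m
  simp [LocalizedModule.mem_ker_mkLinearMap_iff, Submodule.mem_map, Subtype.ext_iff,
    and_comm, -LinearMap.mem_ker]

/-- Let `A` be a commutative Noetherian ring, `M` a nonzero finitely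
generated `A`-module, and `p ≠ q` two associated primes of `M`, both minimal in `Ass(M)`.
With `G = ker (M → M_p)` and `H = ker (M → M_q)`, one has
`G ∩ H = ker (G → G_q) = ker (H → H_p)` (the latter two regarded as submodules of `M`). -/
theorem inf_ker_localization_eq
    {A : Type*} [CommRing A] [IsNoetherianRing A]
    {M : Type*} [AddCommGroup M] [Module A M] [Module.Finite A M] [Nontrivial M]
    (p q : Ideal A) [p.IsPrime] [q.IsPrime]
    (hp : p ∈ associatedPrimes A M) (hq : q ∈ associatedPrimes A M) (hpq : p ≠ q)
    (hpmin : ∀ r ∈ associatedPrimes A M, ¬ r < p)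
    (hqmin : ∀ r ∈ associatedPrimes A M, ¬ r < q)
    (G H : Submodule A M)
    (hG : G = LinearMap.ker (LocalizedModule.mkLinearMap p.primeCompl M))
    (hH : H = LinearMap.ker (LocalizedModule.mkLinearMap q.primeCompl M)) :
    G ⊓ H =
        Submodule.map G.subtype
          (LinearMap.ker (LocalizedModule.mkLinearMap q.primeCompl ↥G)) ∧
      G ⊓ H =
        Submodule.map H.subtype
          (LinearMap.ker (LocalizedModule.mkLinearMap p.primeCompl ↥H)) := by
  rw [Submodule.map_subtype_ker_mkLinearMap, Submodule.map_subtype_ker_mkLinearMap, ← hG, ← hH]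
  exact ⟨rfl, inf_comm G H⟩
end

section
/- Let A be a commutative Noetherian ring and M a nonzero finitely generated A-module, and let 0 = M_0 ⊆ M_1 ⊆ ⋯ ⊆ M_n = M be a coprimary filtration of M with respect to an enumeration p_1, …, p_n of Ass(M). Fix i with 2 ≤ i ≤ n, write p = p_i and q = p_{i-1}, and assume ¬(p ⊆ q). Let G = ker(M_i → (M_i)_q), the kernel of the canonical localization map of the module M_i at q. Then M_{i-2} ⊆ G ⊆ M_i, Ass(M_i/G) = {q}, Ass(G/M_{i-2}) = {p}, and the chain 0 = M_0 ⊆ ⋯ ⊆ M_{i-2} ⊆ G ⊆ M_i ⊆ ⋯ ⊆ M_n = M is a coprimary filtration of M with respect to the enumeration obtained from p_1, …, p_n by interchanging p_{i-1} and p_i. -/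
/-- A coprimary filtration of `M` with respect to the enumeration `p 0, …, p (n-1)` of its
associated primes: a chain `0 = F 0 ⊆ F 1 ⊆ ⋯ ⊆ F n = M` with
`Ass(F (i+1) / F i) = {p i}` for each `i`. -/
def IsCoprimaryFiltration {A : Type*} [CommRing A] {M : Type*} [AddCommGroup M] [Module A M]
    {n : ℕ} (p : Fin n → Ideal A) (F : Fin (n + 1) → Submodule A M) : Prop :=
  F 0 = ⊥ ∧ F (Fin.last n) = ⊤ ∧ Monotone F ∧
  ∀ i : Fin n,
    associatedPrimes A
      (↥(F i.succ) ⧸ Submodule.comap (F i.succ).subtype (F i.castSucc)) = {p i}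

namespace Submodule

variable {A M : Type*} [CommRing A] [AddCommGroup M] [Module A M]

/-- `I` is a prime ideal of the form `(N : x)` for some `x ∈ L`. For `N ≤ L` over a Noetherian
ring this says that `I` is an associated prime of `L / N`. -/
def IsRelAssociatedPrime (I : Ideal A) (N L : Submodule A M) : Prop :=
  I.IsPrime ∧ ∃ x ∈ L, ∀ a, a ∈ I ↔ a • x ∈ N

theorem mem_associatedPrimes_quotient_iff [IsNoetherianRing A] {I : Ideal A}
    {N L : Submodule A M} :
    I ∈ associatedPrimes A (L ⧸ comap L.subtype N) ↔ IsRelAssociatedPrime I N L := by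
  have key (x : L) (a : A) :
      a ∈ (⊥ : Submodule A (L ⧸ comap L.subtype N)).colon {(comap L.subtype N).mkQ x} ↔
        a • (x : M) ∈ N := by
    rw [mem_colon_singleton, mem_bot, ← map_smul, mkQ_apply, Quotient.mk_eq_zero]
    simp
  rw [AssociatedPrimes.mem_iff, isAssociatedPrime_iff]
  refine and_congr_right fun _ => ⟨?_, ?_⟩
  · rintro ⟨x, hx⟩
    obtain ⟨x, rfl⟩ := mkQ_surjective _ x
    exact ⟨x, x.2, fun a => by rw [hx, key]⟩
  · rintro ⟨x, hxL, hx⟩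
    exact ⟨mkQ _ ⟨x, hxL⟩, Ideal.ext fun a => by rw [hx, key]⟩

theorem associatedPrimes_quotient_eq_singleton_iff [IsNoetherianRing A] {P : Ideal A}
    {N L : Submodule A M} :
    associatedPrimes A (L ⧸ comap L.subtype N) = {P} ↔
      ∀ I, IsRelAssociatedPrime I N L ↔ I = P := by
  simp only [Set.ext_iff, mem_associatedPrimes_quotient_iff, Set.mem_singleton_iff]

theorem exists_isRelAssociatedPrime [IsNoetherianRing A] {N L : Submodule A M} {x : M}
    (hxL : x ∈ L) (hxN : x ∉ N) :
    ∃ I, IsRelAssociatedPrime I N L ∧ ∀ a : A, a • x ∈ N → a ∈ I := by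
  obtain ⟨I, hI, hle⟩ := exists_le_isAssociatedPrime_of_isNoetherianRing A
    ((comap L.subtype N).mkQ ⟨x, hxL⟩) (by simpa using hxN)
  refine ⟨I, mem_associatedPrimes_quotient_iff.1 hI, fun a ha => hle ?_⟩
  rw [mem_colon_singleton, mem_bot, ← map_smul, mkQ_apply, Quotient.mk_eq_zero]
  simpa using ha

namespace IsRelAssociatedPrime

variable {I : Ideal A} {N P L : Submodule A M}

/-- If `x` witnesses that `I` is associated to `L / N` and some `a ∉ I` moves `x` into `P`, then
`a • x` witnesses that `I` is associated to `P / N`. -/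
theorem of_smul_mem (hI : I.IsPrime) {x : M} (hx : ∀ a, a ∈ I ↔ a • x ∈ N) {a : A}
    (ha : a ∉ I) (hax : a • x ∈ P) : IsRelAssociatedPrime I N P := by
  refine ⟨hI, a • x, hax, fun b => ?_⟩
  rw [smul_smul, ← hx, hI.mul_mem_iff_mem_or_mem, or_iff_left ha]

theorem or_of_le (h : IsRelAssociatedPrime I N L) (hNP : N ≤ P) :
    IsRelAssociatedPrime I N P ∨ IsRelAssociatedPrime I P L := by
  obtain ⟨hI, x, hxL, hx⟩ := h
  by_cases hc : ∀ a, a • x ∈ P → a ∈ I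
  · exact .inr ⟨hI, x, hxL, fun a => ⟨fun ha => hNP ((hx a).1 ha), hc a⟩⟩
  · push Not at hc
    obtain ⟨a, haP, haI⟩ := hc
    exact .inl (of_smul_mem hI hx haI haP)

end IsRelAssociatedPrime

/-- If every `a ∈ I` is moved into the `q`-saturation of `N`, a single multiplier works for `I`. -/
theorem exists_notMem_forall_smul_mem_of_fg {q I : Ideal A} (hq : q.IsPrime) (hI : I.FG)
    {N : Submodule A M} {y : M} (h : ∀ a ∈ I, ∃ s ∉ q, s • a • y ∈ N) :
    ∃ s ∉ q, ∀ a ∈ I, s • a • y ∈ N := by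
  induction I, hI using fg_induction with
  | singleton b =>
    obtain ⟨s, hs, hsb⟩ := h b (mem_span_singleton_self b)
    refine ⟨s, hs, fun a ha => ?_⟩
    obtain ⟨c, rfl⟩ := mem_span_singleton.1 ha
    rw [smul_assoc, smul_comm]
    exact N.smul_mem c hsb
  | sup I J _ _ hI hJ =>
    obtain ⟨s, hs, hsI⟩ := hI fun a ha => h a (mem_sup_left ha)
    obtain ⟨t, ht, htJ⟩ := hJ fun a ha => h a (mem_sup_right ha)
    refine ⟨s * t, fun hst => (hq.mem_or_mem hst).elim hs ht, fun a ha => ?_⟩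
    obtain ⟨b, hb, c, hc, rfl⟩ := mem_sup.1 ha
    rw [add_smul, smul_add]
    refine N.add_mem ?_ ?_
    · rw [mul_comm, mul_smul]
      exact N.smul_mem t (hsI b hb)
    · rw [mul_smul]
      exact N.smul_mem s (htJ c hc)

/-- The elements of `M` that some element outside the prime `q` multiplies into `N`. -/
def primeSaturation (q : Ideal A) (hq : q.IsPrime) (N : Submodule A M) : Submodule A M where
  carrier := {x | ∃ s ∉ q, s • x ∈ N}
  zero_mem' := ⟨1, hq.one_notMem, by simp⟩
  add_mem' := by
    rintro x y ⟨s, hs, hx⟩ ⟨t, ht, hy⟩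
    refine ⟨s * t, fun hst => (hq.mem_or_mem hst).elim hs ht, ?_⟩
    rw [smul_add]
    refine N.add_mem ?_ ?_
    · rw [mul_comm, mul_smul]
      exact N.smul_mem t hx
    · rw [mul_smul]
      exact N.smul_mem s hy
  smul_mem' := by
    rintro c x ⟨s, hs, hx⟩
    exact ⟨s, hs, by rw [smul_comm]; exact N.smul_mem c hx⟩

variable {q : Ideal A} {N L : Submodule A M}

theorem mem_primeSaturation {hq : q.IsPrime} {x : M} :
    x ∈ primeSaturation q hq N ↔ ∃ s ∉ q, s • x ∈ N :=
  Iff.rfl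

theorem mem_primeSaturation_of_smul_mem {hq : q.IsPrime} {x : M} {s : A} (hs : s ∉ q)
    (hx : s • x ∈ primeSaturation q hq N) : x ∈ primeSaturation q hq N := by
  obtain ⟨t, ht, htx⟩ := hx
  exact ⟨t * s, fun hts => (hq.mem_or_mem hts).elim ht hs, by rwa [mul_smul]⟩

/-- If no associated prime of `L / N` is contained in `q`, then `(L / N)_q = 0`. -/
theorem le_primeSaturation [IsNoetherianRing A] (hq : q.IsPrime)
    (h : ∀ I, IsRelAssociatedPrime I N L → ¬ I ≤ q) : L ≤ primeSaturation q hq N := by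
  intro x hxL
  by_contra hx
  obtain ⟨I, ⟨hI, y, hyL, hy⟩, -⟩ := exists_isRelAssociatedPrime hxL hx
  have hyT : y ∉ primeSaturation q hq N := fun hyT =>
    hI.one_notMem ((hy 1).2 (by rwa [one_smul]))
  have hIq : I ≤ q := fun a ha => by
    by_contra haq
    exact hyT (mem_primeSaturation_of_smul_mem haq ((hy a).1 ha))
  obtain ⟨s, hs, hsI⟩ := exists_notMem_forall_smul_mem_of_fg hq (IsNoetherian.noetherian I)
    fun a ha => mem_primeSaturation.1 ((hy a).1 ha)
  refine h I ⟨hI, s • y, L.smul_mem s hyL, fun a => ⟨fun ha => ?_, fun ha => ?_⟩⟩ hIq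
  · rw [smul_comm]
    exact hsI a ha
  · rw [smul_comm] at ha
    exact (hy a).2 ⟨s, hs, ha⟩

/-- If `q` is the only associated prime of `L / N`, then `L / N` embeds in its localization
at `q`. -/
theorem mem_of_smul_mem_of_isRelAssociatedPrime [IsNoetherianRing A]
    (h : ∀ I, IsRelAssociatedPrime I N L → I = q) {x : M} (hxL : x ∈ L) {s : A} (hs : s ∉ q)
    (hx : s • x ∈ N) : x ∈ N := by
  by_contra hxN
  obtain ⟨I, hI, hle⟩ := exists_isRelAssociatedPrime hxL hxN
  exact hs (h I hI ▸ hle s hx)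

theorem mem_map_ker_mkLinearMap_iff (hq : q.IsPrime) {x : M} :
    x ∈ map L.subtype (LinearMap.ker (LocalizedModule.mkLinearMap q.primeCompl L)) ↔
      x ∈ L ∧ x ∈ primeSaturation q hq ⊥ := by
  simp only [mem_map, LinearMap.mem_ker, subtype_apply, Subtype.exists, mem_primeSaturation,
    IsLocalizedModule.eq_zero_iff q.primeCompl, mem_bot, Submonoid.smul_def, Subtype.ext_iff]
  constructor
  · rintro ⟨y, hy, ⟨s, hs, h⟩, rfl⟩
    exact ⟨hy, s, hs, by simpa using h⟩
  · rintro ⟨hx, s, hs, h⟩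
    exact ⟨x, hx, ⟨s, hs, by simpa using h⟩, rfl⟩

/-- Interchanging the two factors of a chain `N ≤ P ≤ L` with `Ass (P / N) = {q}` and
`Ass (L / P) = {p}`, where `¬ p ≤ q`, by passing to `ker (L → (L / N)_q)`. -/
theorem isRelAssociatedPrime_inf_primeSaturation [IsNoetherianRing A] {p : Ideal A}
    (hq : q.IsPrime) {P : Submodule A M} (hNP : N ≤ P) (hPL : P ≤ L)
    (hPN : ∀ I, IsRelAssociatedPrime I N P ↔ I = q)
    (hLP : ∀ I, IsRelAssociatedPrime I P L ↔ I = p)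
    (hp : IsRelAssociatedPrime p N L) (hpq : ¬ p ≤ q) :
    (∀ I, IsRelAssociatedPrime I (L ⊓ primeSaturation q hq N) L ↔ I = q) ∧
      ∀ I, IsRelAssociatedPrime I N (L ⊓ primeSaturation q hq N) ↔ I = p := by
  set G := L ⊓ primeSaturation q hq N
  have hNG : N ≤ G := le_inf (hNP.trans hPL) fun x hx => ⟨1, hq.one_notMem, by rwa [one_smul]⟩
  have hPG {x : M} (hxP : x ∈ P) (hxG : x ∈ G) : x ∈ N := by
    obtain ⟨s, hs, hx⟩ := hxG.2
    exact mem_of_smul_mem_of_isRelAssociatedPrime (fun I => (hPN I).1) hxP hs hx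
  have hLG (I : Ideal A) (h : IsRelAssociatedPrime I G L) : I = q := by
    obtain ⟨hI, x, hxL, hx⟩ := h
    have hxG : x ∉ G := fun hxG => hI.one_notMem ((hx 1).2 (by rwa [one_smul]))
    obtain ⟨s, hs, hsx⟩ : x ∈ primeSaturation q hq P :=
      le_primeSaturation hq (fun I hI => (hLP I).1 hI ▸ hpq) hxL
    have hsI : s ∉ I := fun h => hxG
      ⟨hxL, mem_primeSaturation_of_smul_mem hs ((hx s).1 h).2⟩
    obtain ⟨-, y, hyP, hy⟩ := IsRelAssociatedPrime.of_smul_mem hI hx hsI hsx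
    exact (hPN I).1 ⟨hI, y, hyP, fun a =>
      ⟨fun ha => hPG (P.smul_mem a hyP) ((hy a).1 ha), fun ha => (hy a).2 (hNG ha)⟩⟩
  refine ⟨fun I => ⟨hLG I, ?_⟩, fun I => ⟨fun h => ?_, ?_⟩⟩
  · rintro rfl
    obtain ⟨hI, y, hyP, hy⟩ := (hPN I).2 rfl
    exact ⟨hI, y, hPL hyP, fun a => ⟨fun ha => hNG ((hy a).1 ha),
      fun ha => (hy a).2 (hPG (P.smul_mem a hyP) ha)⟩⟩
  · obtain ⟨hI, x, hxG, hx⟩ := h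
    exact (hLP I).1 ⟨hI, x, hxG.1, fun a => ⟨fun ha => hNP ((hx a).1 ha),
      fun ha => (hx a).2 (hPG ha (G.smul_mem a hxG))⟩⟩
  · rintro rfl
    exact (hp.or_of_le hNG).resolve_right fun h => hpq (hLG I h).le

end Submodule

open Submodule in
/-- The associated primes of `F b / F a` for a coprimary filtration `F` are among the `p i` with
`a ≤ i < b`. -/
theorem IsCoprimaryFiltration.exists_eq_of_isRelAssociatedPrime {A M : Type*} [CommRing A]
    [IsNoetherianRing A] [AddCommGroup M] [Module A M] {n : ℕ} {p : Fin n → Ideal A}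
    {F : Fin (n + 1) → Submodule A M} (hF : IsCoprimaryFiltration p F) {I : Ideal A}
    {a b : Fin (n + 1)} (hab : a ≤ b) (h : IsRelAssociatedPrime I (F a) (F b)) :
    ∃ i : Fin n, a ≤ i.castSucc ∧ i.castSucc < b ∧ I = p i := by
  obtain ⟨-, -, hmono, hAss⟩ := hF
  induction b using Fin.induction with
  | zero =>
    obtain rfl : a = 0 := Fin.le_zero_iff.1 hab
    obtain ⟨hI, x, hx, hxI⟩ := h
    exact (hI.one_notMem ((hxI 1).2 (by rwa [one_smul]))).elim
  | succ b ih =>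
    rcases hab.eq_or_lt with rfl | hab
    · obtain ⟨hI, x, hx, hxI⟩ := h
      exact (hI.one_notMem ((hxI 1).2 (by rwa [one_smul]))).elim
    · have hab' : a ≤ b.castSucc := Fin.le_castSucc_iff.2 hab
      rcases h.or_of_le (hmono hab') with h | h
      · obtain ⟨i, hai, hib, hi⟩ := ih hab' h
        exact ⟨i, hai, hib.trans Fin.castSucc_lt_succ, hi⟩
      · exact ⟨b, hab', Fin.castSucc_lt_succ,
          (associatedPrimes_quotient_eq_singleton_iff.1 (hAss b) I).1 h⟩

/-- An adjacent transposition preserves strict inequalities except between the two indices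
it interchanges. -/
theorem Fin.lt_of_swap_lt_swap {n : ℕ} {j k a b : Fin n} (hjk : (j : ℕ) + 1 = k)
    (h : Equiv.swap j k b < Equiv.swap j k a)
    (hne : ¬ (Equiv.swap j k b = j ∧ Equiv.swap j k a = k)) : b < a := by
  simp only [Equiv.swap_apply_def] at h hne
  grind

/-- Let `0 = M₀ ⊆ ⋯ ⊆ Mₙ = M` be a coprimary filtration of a nonzero
finitely generated module `M` over a Noetherian ring `A` with respect to an enumeration
`p 0, …, p (n-1)` of `Ass(M)`.  Fix adjacent indices `j, k` (`j + 1 = k`) and assume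
`¬(p k ⊆ p j)`.  Let `G = ker (M_{k+1} → (M_{k+1})_{p j})`, regarded as a submodule of `M`.
Then `M_{j} ⊆ G ⊆ M_{k+1}`, `Ass(M_{k+1}/G) = {p j}`, `Ass(G/M_j) = {p k}`, and replacing
`M_k` by `G` yields a coprimary filtration with respect to the enumeration obtained by
interchanging `p j` and `p k`. -/
theorem coprimaryFiltration_swap
    {A : Type*} [CommRing A] [IsNoetherianRing A]
    {M : Type*} [AddCommGroup M] [Module A M] [Module.Finite A M] [Nontrivial M]
    {n : ℕ} (p : Fin n → Ideal A) (hprime : ∀ i, (p i).IsPrime)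
    (hinj : Function.Injective p)
    (hAss : associatedPrimes A M = Set.range p)
    (horder : ∀ a b, p a < p b → b < a)
    (F : Fin (n + 1) → Submodule A M) (hF : IsCoprimaryFiltration p F)
    (j k : Fin n) (hjk : (j : ℕ) + 1 = (k : ℕ))
    (hns : ¬ p k ≤ p j)
    (G : Submodule A M)
    (hG : G = Submodule.map (F k.succ).subtype
      (LinearMap.ker (LocalizedModule.mkLinearMap
        (@Ideal.primeCompl A _ (p j) (hprime j)) ↥(F k.succ)))) :
    F j.castSucc ≤ G ∧ G ≤ F k.succ ∧
      associatedPrimes A (↥(F k.succ) ⧸ Submodule.comap (F k.succ).subtype G) = {p j} ∧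
      associatedPrimes A (↥G ⧸ Submodule.comap G.subtype (F j.castSucc)) = {p k} ∧
      IsCoprimaryFiltration (p ∘ Equiv.swap j k) (Function.update F k.castSucc G) ∧
      (∀ a b, (p ∘ Equiv.swap j k) a < (p ∘ Equiv.swap j k) b → b < a) := by
  obtain ⟨hF0, hFtop, hmono, hFAss⟩ := id hF
  have hjk' : j.succ = k.castSucc := Fin.ext hjk
  have hjlt : j.castSucc < k.castSucc := hjk' ▸ Fin.castSucc_lt_succ
  have hFjk : F j.castSucc ≤ F k.castSucc := hmono hjlt.le
  have hFkk : F k.castSucc ≤ F k.succ := hmono Fin.castSucc_lt_succ.le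
  have hFj := Submodule.associatedPrimes_quotient_eq_singleton_iff.1 (hFAss j)
  have hFk := Submodule.associatedPrimes_quotient_eq_singleton_iff.1 (hFAss k)
  rw [hjk'] at hFj
  have hFj_sat : F j.castSucc ≤ Submodule.primeSaturation (p j) (hprime j) ⊥ := by
    refine Submodule.le_primeSaturation _ fun I hI hIq => ?_
    rw [← hF0] at hI
    obtain ⟨i, -, hij, rfl⟩ := hF.exists_eq_of_isRelAssociatedPrime (Fin.zero_le _) hI
    have hij : i < j := hij
    exact hij.not_gt (horder i j (hIq.lt_of_ne (hinj.ne hij.ne)))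
  have hGeq : G = F k.succ ⊓ Submodule.primeSaturation (p j) (hprime j) (F j.castSucc) := by
    ext x
    rw [hG, Submodule.mem_map_ker_mkLinearMap_iff (hprime j), Submodule.mem_inf]
    refine and_congr_right fun _ => ⟨?_, ?_⟩
    · rintro ⟨s, hs, hx⟩
      exact ⟨s, hs, (bot_le : ⊥ ≤ F j.castSucc) hx⟩
    · rintro ⟨s, hs, hx⟩
      exact Submodule.mem_primeSaturation_of_smul_mem hs (hFj_sat hx)
  have hpk : Submodule.IsRelAssociatedPrime (p k) (F j.castSucc) (F k.succ) := by
    have htop : Submodule.IsRelAssociatedPrime (p k) (F 0) (F (Fin.last n)) := by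
      have hk : p k ∈ associatedPrimes A M := hAss ▸ Set.mem_range_self k
      obtain ⟨hI, x, hx⟩ := isAssociatedPrime_iff.1 hk
      refine ⟨hI, x, by simp [hFtop], fun a => ?_⟩
      rw [hx, Submodule.mem_colon_singleton, hF0]
    have hsucc := (htop.or_of_le (hmono (Fin.zero_le k.succ))).resolve_right fun h => by
      obtain ⟨i, hki, -, hi⟩ := hF.exists_eq_of_isRelAssociatedPrime (Fin.le_last _) h
      obtain rfl := hinj hi
      exact hki.not_gt Fin.castSucc_lt_succ
    refine (hsucc.or_of_le (hmono (Fin.zero_le j.castSucc))).resolve_left fun h => ?_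
    obtain ⟨i, -, hij, hi⟩ := hF.exists_eq_of_isRelAssociatedPrime (Fin.zero_le _) h
    obtain rfl := hinj hi
    exact hij.not_gt hjlt
  have hswap := Submodule.isRelAssociatedPrime_inf_primeSaturation (hprime j) hFjk hFkk hFj hFk
    hpk hns
  rw [← hGeq] at hswap
  have hjG : F j.castSucc ≤ G := by
    rw [hGeq]
    exact le_inf (hFjk.trans hFkk) fun x hx => ⟨1, (hprime j).one_notMem, by rwa [one_smul]⟩
  have hGk : G ≤ F k.succ := hGeq ▸ inf_le_left
  have hAssGk := Submodule.associatedPrimes_quotient_eq_singleton_iff.2 hswap.1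
  have hAssGj := Submodule.associatedPrimes_quotient_eq_singleton_iff.2 hswap.2
  refine ⟨hjG, hGk, hAssGk, hAssGj, ⟨?_, ?_, ?_, fun i => ?_⟩, fun a b hab => ?_⟩
  · rw [Function.update_of_ne (Fin.ne_of_lt ((Fin.zero_le _).trans_lt hjlt)), hF0]
  · rw [Function.update_of_ne (Fin.castSucc_lt_last k).ne', hFtop]
  · refine Fin.monotone_iff_le_succ.2 fun i => ?_
    rcases eq_or_ne i j with rfl | hij
    · rwa [hjk', Function.update_self, Function.update_of_ne hjlt.ne]
    have hi : i.succ ≠ k.castSucc := fun h => hij (Fin.succ_injective _ (h.trans hjk'.symm))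
    rw [Function.update_of_ne hi]
    rcases eq_or_ne i k with rfl | hik
    · rwa [Function.update_self]
    · rw [Function.update_of_ne (Fin.castSucc_injective _ |>.ne hik)]
      exact hmono Fin.castSucc_lt_succ.le
  · rcases eq_or_ne i j with rfl | hij
    · rw [hjk', Function.update_self, Function.update_of_ne hjlt.ne, Function.comp_apply,
        Equiv.swap_apply_left]
      exact hAssGj
    have hi : i.succ ≠ k.castSucc := fun h => hij (Fin.succ_injective _ (h.trans hjk'.symm))
    rw [Function.update_of_ne hi]
    rcases eq_or_ne i k with rfl | hik
    · rw [Function.update_self, Function.comp_apply, Equiv.swap_apply_right]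
      exact hAssGk
    · rw [Function.update_of_ne (Fin.castSucc_injective _ |>.ne hik), Function.comp_apply,
        Equiv.swap_apply_of_ne_of_ne hij hik]
      exact hFAss i
  · refine Fin.lt_of_swap_lt_swap hjk (horder _ _ hab) fun ⟨hb, ha⟩ => hns ?_
    rw [Function.comp_apply, Function.comp_apply, ha, hb] at hab
    exact hab.le
end

section
/- Let A be a commutative Noetherian ring, M a nonzero finitely generated A-module, and p, q two distinct associated primes of M that are both minimal in Ass(M) (no element of Ass(M) is strictly contained in p or in q). Assume p + q = A (equivalently, no prime ideal of A contains both p and q). Then ker(M → M_p) + ker(M → M_q) = M, where ker(M → M_p) and ker(M → M_q) are the kernels of the canonical localization maps of M at p and at q. -/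
/-- A minimal element of `Ass(M)` is a minimal prime over the annihilator of `M`. -/
theorem mem_minimalPrimes_annihilator_of_minimal_associatedPrimes
    {A : Type*} [CommRing A] [IsNoetherianRing A]
    {M : Type*} [AddCommGroup M] [Module A M] [Module.Finite A M]
    {p : Ideal A} (hp : p ∈ associatedPrimes A M)
    (hpmin : ∀ r ∈ associatedPrimes A M, ¬ r < p) :
    p ∈ (Module.annihilator A M).minimalPrimes := by
  have : p.IsPrime := hp.isPrime
  obtain ⟨r, hr, hrp⟩ := Ideal.exists_minimalPrimes_le
    (Submodule.annihilator_top (R := A) (M := M) ▸ hp.annihilator_le)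
  have hrass := Module.associatedPrimes.minimalPrimes_annihilator_subset_associatedPrimes A M hr
  rwa [← eq_of_le_of_not_lt hrp (hpmin r hrass)]

/-- If `p` is a minimal prime over the annihilator of `M`, every element of `p` has a power
mapping `M` into the kernel of `M → M_p`. -/
theorem le_radical_annihilator_quotient_ker_mkLinearMap
    {A : Type*} [CommRing A] {M : Type*} [AddCommGroup M] [Module A M]
    {p : Ideal A} [p.IsPrime] (hp : p ∈ (Module.annihilator A M).minimalPrimes) :
    p ≤ (Module.annihilator A
      (M ⧸ LinearMap.ker (LocalizedModule.mkLinearMap p.primeCompl M))).radical := by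
  intro x hx
  obtain ⟨y, hy, n, hxy⟩ : ∃ y ∉ p, ∃ n, y * x ^ n ∈ Module.annihilator A M := by
    by_contra! h
    have hdisj : Disjoint (Module.annihilator A M : Set A)
        (p.primeCompl ⊔ Submonoid.powers x : Submonoid A) := by
      refine Set.disjoint_left.mpr fun z hz hz' ↦ ?_
      obtain ⟨y, hy, _, ⟨n, rfl⟩, rfl⟩ := Submonoid.mem_sup.mp hz'
      exact h y hy n hz
    obtain ⟨r, hr, hle, hrd⟩ := Ideal.exists_le_prime_disjoint _ _ hdisj
    have hrp : r ≤ p := fun z hz ↦ by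
      by_contra hzp
      exact Set.disjoint_left.mp hrd hz (Submonoid.mem_sup_left hzp)
    exact Set.disjoint_left.mp hrd (hp.2 ⟨hr, hle⟩ hrp hx)
      (Submonoid.mem_sup_right (Submonoid.mem_powers x))
  refine ⟨n, Module.mem_annihilator.mpr fun m ↦ ?_⟩
  obtain ⟨m, rfl⟩ := Submodule.mkQ_surjective _ m
  rw [← map_smul, Submodule.mkQ_apply, Submodule.Quotient.mk_eq_zero, LinearMap.mem_ker,
    IsLocalizedModule.eq_zero_iff p.primeCompl]
  exact ⟨⟨y, hy⟩, by simpa [Submonoid.smul_def, mul_smul] using Module.mem_annihilator.mp hxy m⟩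

/-- If the annihilators of `M ⧸ N` and `M ⧸ N'` are comaximal, then `N + N' = M`. -/
theorem sup_eq_top_of_annihilator_quotient_sup_eq_top
    {A : Type*} [CommRing A] {M : Type*} [AddCommGroup M] [Module A M] {N N' : Submodule A M}
    (h : Module.annihilator A (M ⧸ N) ⊔ Module.annihilator A (M ⧸ N') = ⊤) : N ⊔ N' = ⊤ := by
  obtain ⟨a, ha, b, hb, hab⟩ := Submodule.mem_sup.mp ((Ideal.eq_top_iff_one _).mp h)
  refine eq_top_iff.mpr fun m _ ↦ ?_
  rw [← one_smul A m, ← hab, add_smul]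
  refine Submodule.add_mem_sup ?_ ?_
  · simpa [← Submodule.Quotient.mk_smul] using
      Module.mem_annihilator.mp ha (Submodule.Quotient.mk m)
  · simpa [← Submodule.Quotient.mk_smul] using
      Module.mem_annihilator.mp hb (Submodule.Quotient.mk m)

/-- Let `A` be a commutative Noetherian ring, `M` a nonzero finitely
generated `A`-module, and `p ≠ q` two associated primes of `M`, both minimal in `Ass(M)`,
with `p + q = A`.  Then `ker (M → M_p) + ker (M → M_q) = M`. -/
theorem ker_localization_sup_eq_top
    {A : Type*} [CommRing A] [IsNoetherianRing A]
    {M : Type*} [AddCommGroup M] [Module A M] [Module.Finite A M] [Nontrivial M]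
    (p q : Ideal A) [p.IsPrime] [q.IsPrime]
    (hp : p ∈ associatedPrimes A M) (hq : q ∈ associatedPrimes A M) (hpq : p ≠ q)
    (hpmin : ∀ r ∈ associatedPrimes A M, ¬ r < p)
    (hqmin : ∀ r ∈ associatedPrimes A M, ¬ r < q)
    (hcomax : p ⊔ q = ⊤) :
    LinearMap.ker (LocalizedModule.mkLinearMap p.primeCompl M) ⊔
      LinearMap.ker (LocalizedModule.mkLinearMap q.primeCompl M) = ⊤ := by
  apply sup_eq_top_of_annihilator_quotient_sup_eq_top
  rw [← Ideal.radical_eq_top, Ideal.radical_sup, Ideal.radical_eq_top, eq_top_iff, ← hcomax]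
  exact sup_le_sup
    (le_radical_annihilator_quotient_ker_mkLinearMap
      (mem_minimalPrimes_annihilator_of_minimal_associatedPrimes hp hpmin))
    (le_radical_annihilator_quotient_ker_mkLinearMap
      (mem_minimalPrimes_annihilator_of_minimal_associatedPrimes hq hqmin))
end

section
/- Let A be a commutative Noetherian ring and M a nonzero finitely generated A-module. Assume that for all p, q ∈ Ass(M) with ¬(p ⊆ q) and ¬(q ⊆ p), one has p + q = A (equivalently, no prime ideal of A contains both p and q). Then any two coprimary filtrations of M are equivalent: if 0 = M_0 ⊆ ⋯ ⊆ M_n = M is a coprimary filtration with respect to an enumeration p_1, …, p_n of Ass(M) and 0 = N_0 ⊆ ⋯ ⊆ N_n = M is a coprimary filtration with respect to an enumeration q_1, …, q_n of Ass(M), then M_i/M_{i-1} ≅ N_j/N_{j-1} as A-modules whenever p_i = q_j. -/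
namespace Submodule

variable {A : Type*} [CommRing A] {M : Type*} [AddCommGroup M] [Module A M]

/-- The elements of `M` on which every element of `I` acts nilpotently. -/
def nilTorsion (M : Type*) [AddCommGroup M] [Module A M] (I : Ideal A) : Submodule A M where
  carrier := {x | ∀ a ∈ I, ∃ k : ℕ, a ^ k • x = 0}
  zero_mem' _ _ := ⟨0, smul_zero _⟩
  add_mem' := by
    intro x y hx hy a ha
    obtain ⟨k, hk⟩ := hx a ha
    obtain ⟨l, hl⟩ := hy a ha
    refine ⟨k + l, ?_⟩
    rw [smul_add, pow_add, mul_smul _ _ y, hl, mul_comm, mul_smul, hk, smul_zero, smul_zero,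
      add_zero]
  smul_mem' := by
    intro c x hx a ha
    obtain ⟨k, hk⟩ := hx a ha
    exact ⟨k, by rw [smul_comm, hk, smul_zero]⟩

theorem mem_nilTorsion {I : Ideal A} {x : M} :
    x ∈ nilTorsion M I ↔ ∀ a ∈ I, ∃ k : ℕ, a ^ k • x = 0 :=
  Iff.rfl

theorem nilTorsion_anti {I J : Ideal A} (h : I ≤ J) : nilTorsion M J ≤ nilTorsion M I :=
  fun _ hx a ha ↦ hx a (h ha)

theorem nilTorsion_sup (I J : Ideal A) :
    nilTorsion M (I ⊔ J) = nilTorsion M I ⊓ nilTorsion M J := by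
  refine le_antisymm (le_inf (nilTorsion_anti le_sup_left) (nilTorsion_anti le_sup_right)) ?_
  rintro x ⟨hI, hJ⟩
  have key : ∀ K : Ideal A, x ∈ nilTorsion M K ↔ K ≤ ((⊥ : Submodule A M).colon {x}).radical := by
    intro K
    simp only [mem_nilTorsion, SetLike.le_def, Ideal.mem_radical_iff, mem_colon_singleton, mem_bot]
  exact (key _).2 (sup_le ((key _).1 hI) ((key _).1 hJ))

theorem nilTorsion_inf_le_sup [IsNoetherianRing A] {I J : Ideal A} (h : I ⊔ J = ⊤) :
    nilTorsion M (I ⊓ J) ≤ nilTorsion M I ⊔ nilTorsion M J := by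
  intro x hx
  have hle : I ⊓ J ≤ ((⊥ : Submodule A M).colon {x}).radical := by
    intro a ha
    obtain ⟨k, hk⟩ := hx a ha
    exact ⟨k, by simpa [mem_colon_singleton] using hk⟩
  obtain ⟨k, hk⟩ := Ideal.exists_pow_le_of_le_radical_of_fg hle (IsNoetherian.noetherian _)
  have hzero : ∀ a ∈ I, ∀ b ∈ J, (a * b) ^ k • x = 0 := fun a ha b hb ↦ by
    simpa [mem_colon_singleton] using
      hk (Ideal.pow_mem_pow (mem_inf.2 ⟨I.mul_mem_right b ha, J.mul_mem_left a hb⟩) k)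
  obtain ⟨a, ha, b, hb, hab⟩ := Submodule.mem_sup.1 (h ▸ mem_top : (1 : A) ∈ I ⊔ J)
  obtain ⟨u, v, huv⟩ : IsCoprime (b ^ k) (a ^ k) :=
    IsCoprime.pow ⟨1, 1, by rw [one_mul, one_mul, add_comm, hab]⟩
  refine mem_sup.2 ⟨(u * b ^ k) • x, fun c hc ↦ ⟨k, ?_⟩, (v * a ^ k) • x, fun c hc ↦ ⟨k, ?_⟩, ?_⟩
  · rw [smul_smul, show c ^ k * (u * b ^ k) = u * (c * b) ^ k by ring, mul_smul, hzero c hc b hb,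
      smul_zero]
  · rw [smul_smul, show c ^ k * (v * a ^ k) = v * (a * c) ^ k by ring, mul_smul, hzero a ha c hc,
      smul_zero]
  · rw [← add_smul, huv, one_smul]

end Submodule

/-- An element of the only associated prime of a module acts locally nilpotently on it. -/
theorem exists_pow_smul_eq_zero_of_associatedPrimes_eq_singleton
    {A : Type*} [CommRing A] [IsNoetherianRing A] {N : Type*} [AddCommGroup N] [Module A N]
    {p : Ideal A} (h : associatedPrimes A N = {p}) {a : A} (ha : a ∈ p) (x : N) :
    ∃ k : ℕ, a ^ k • x = 0 := by
  suffices a ∈ ((⊥ : Submodule A N).colon {x}).radical by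
    simpa [Ideal.mem_radical_iff, Submodule.mem_colon_singleton] using this
  rw [← Ideal.sInf_minimalPrimes, Submodule.mem_sInf]
  intro P hP
  have hmem : P ∈ associatedPrimes A N :=
    isAssociatedPrime_iff.2 ⟨hP.isPrime, Submodule.exists_eq_colon_of_mem_minimalPrimes hP⟩
  rw [h, Set.mem_singleton_iff] at hmem
  exact hmem ▸ ha

theorem Ideal.IsPrime.exists_le_of_sInf_le {A : Type*} [CommRing A] {P : Ideal A} (hP : P.IsPrime)
    {S : Set (Ideal A)} (hS : S.Finite) (h : sInf S ≤ P) : ∃ q ∈ S, q ≤ P := by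
  obtain ⟨q, hq, hle⟩ := (hP.inf_le' (s := hS.toFinset) (f := id)).1
    (by rwa [Finset.inf_id_eq_sInf, hS.coe_toFinset])
  exact ⟨q, hS.mem_toFinset.1 hq, hle⟩

namespace IsCoprimaryFiltration

open Submodule

variable {A : Type*} [CommRing A] {M : Type*} [AddCommGroup M] [Module A M]
  {n : ℕ} {p : Fin n → Ideal A} {F : Fin (n + 1) → Submodule A M}

theorem isPrime (hF : IsCoprimaryFiltration p F) (i : Fin n) : (p i).IsPrime := by
  have h : p i ∈ associatedPrimes A
      (↥(F i.succ) ⧸ Submodule.comap (F i.succ).subtype (F i.castSucc)) := by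
    rw [hF.2.2.2 i]; rfl
  exact h.1

variable [IsNoetherianRing A]

theorem exists_pow_smul_mem (hF : IsCoprimaryFiltration p F) {i : Fin n} {a : A} (ha : a ∈ p i)
    {x : M} (hx : x ∈ F i.succ) : ∃ k : ℕ, a ^ k • x ∈ F i.castSucc := by
  obtain ⟨k, hk⟩ := exists_pow_smul_eq_zero_of_associatedPrimes_eq_singleton (hF.2.2.2 i) ha
    (Submodule.Quotient.mk ⟨x, hx⟩)
  rw [← Submodule.Quotient.mk_smul, Submodule.Quotient.mk_eq_zero] at hk
  exact ⟨k, hk⟩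

theorem mem_castSucc_of_mem_nilTorsion (hF : IsCoprimaryFiltration p F) {i : Fin n} {I : Ideal A}
    (hI : ¬ I ≤ p i) {x : M} (hx : x ∈ F i.succ) (hxI : x ∈ nilTorsion M I) :
    x ∈ F i.castSucc := by
  by_contra hne
  let y : ↥(F i.succ) ⧸ Submodule.comap (F i.succ).subtype (F i.castSucc) :=
    Submodule.Quotient.mk ⟨x, hx⟩
  have hy : y ≠ 0 := fun h ↦ hne <| by simpa using (Submodule.Quotient.mk_eq_zero _).1 h
  obtain ⟨P, hP, hle⟩ := exists_le_isAssociatedPrime_of_isNoetherianRing A y hy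
  have hPi : P = p i := by
    have hmem := AssociatedPrimes.mem_iff.2 hP
    rwa [hF.2.2.2 i, Set.mem_singleton_iff] at hmem
  refine hI fun a ha ↦ ?_
  obtain ⟨k, hk⟩ := hxI a ha
  refine hPi ▸ hP.isPrime.mem_of_pow_mem k (hle ?_)
  rw [mem_colon_singleton, mem_bot, ← Submodule.Quotient.mk_smul, Submodule.Quotient.mk_eq_zero]
  simp [hk]

/-- The steps of a coprimary filtration are determined by the set of primes preceding them. -/
theorem eq_nilTorsion (hF : IsCoprimaryFiltration p F) (hp : Function.Injective p)
    (horder : ∀ a b, p a < p b → b < a) (i : Fin (n + 1)) :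
    F i = nilTorsion M (sInf (p '' {k | k.castSucc < i})) := by
  apply le_antisymm
  · induction i using Fin.induction with
    | zero => rw [hF.1]; exact bot_le
    | succ i ih =>
      intro x hx a ha
      rw [Submodule.mem_sInf] at ha
      obtain ⟨k, hk⟩ := hF.exists_pow_smul_mem (ha _ ⟨i, Fin.castSucc_lt_succ, rfl⟩) hx
      obtain ⟨l, hl⟩ := ih hk a <| Submodule.mem_sInf.2 <| by
        rintro _ ⟨j, hj, rfl⟩
        exact ha _ ⟨j, lt_trans hj Fin.castSucc_lt_succ, rfl⟩
      exact ⟨l + k, by rw [pow_add, mul_smul, hl]⟩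
  · intro x hx
    have hall : ∀ l : Fin (n + 1), i ≤ l → x ∈ F l := by
      intro l
      induction l using Fin.reverseInduction with
      | last => intro _; rw [hF.2.1]; exact mem_top
      | cast l ih =>
        intro hil
        refine hF.mem_castSucc_of_mem_nilTorsion (fun hle ↦ ?_)
          (ih (hil.trans Fin.castSucc_lt_succ.le)) hx
        obtain ⟨_, ⟨k, hk, rfl⟩, hkl⟩ :=
          (hF.isPrime l).exists_le_of_sInf_le (Set.toFinite _) hle
        have hlt : k < l := Fin.castSucc_lt_castSucc_iff.1 (lt_of_lt_of_le hk hil)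
        exact lt_asymm hlt (horder _ _ (lt_of_le_of_ne hkl (hp.ne hlt.ne)))
    exact hall i le_rfl

/-- A subquotient of a coprimary filtration depends only on its prime, as soon as incomparable
primes of the enumeration are comaximal. -/
theorem nonempty_subquotient_equiv (hF : IsCoprimaryFiltration p F) (hp : Function.Injective p)
    (horder : ∀ a b, p a < p b → b < a)
    (hcomax : ∀ a b, ¬ p a ≤ p b → ¬ p b ≤ p a → p a ⊔ p b = ⊤) (i : Fin n) :
    Nonempty ((↥(F i.succ) ⧸ Submodule.comap (F i.succ).subtype (F i.castSucc)) ≃ₗ[A]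
      (↥(nilTorsion M (sInf {q ∈ Set.range p | p i ≤ q})) ⧸
        Submodule.comap (nilTorsion M (sInf {q ∈ Set.range p | p i ≤ q})).subtype
          (nilTorsion M (sInf {q ∈ Set.range p | p i < q})))) := by
  set I := sInf {q ∈ Set.range p | p i ≤ q}
  set I₀ := sInf {q ∈ Set.range p | p i < q}
  set J := sInf (p '' {k | k < i ∧ ¬ p i ≤ p k})
  have hIJ : I ⊔ J = ⊤ := by
    by_contra hne
    obtain ⟨P, hP, hle⟩ := Ideal.exists_le_maximal _ hne
    obtain ⟨q, ⟨-, hq⟩, hqP⟩ :=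
      hP.isPrime.exists_le_of_sInf_le (Set.toFinite _) (le_sup_left.trans hle)
    obtain ⟨_, ⟨k, ⟨hki, hk⟩, rfl⟩, hkP⟩ :=
      hP.isPrime.exists_le_of_sInf_le (Set.toFinite _) (le_sup_right.trans hle)
    have hki' : ¬ p k ≤ p i := fun h ↦
      lt_asymm hki (horder _ _ (lt_of_le_of_ne h (hp.ne hki.ne)))
    exact hP.ne_top (top_le_iff.1 (hcomax i k hk hki' ▸ sup_le (hq.trans hqP) hkP))
  have hlow := hF.eq_nilTorsion hp horder i.castSucc
  have hhigh := hF.eq_nilTorsion hp horder i.succ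
  set K := sInf (p '' {k | k.castSucc < i.castSucc})
  set L := sInf (p '' {k | k.castSucc < i.succ})
  have hII₀ : I ≤ I₀ := sInf_le_sInf fun q hq ↦ ⟨hq.1, hq.2.le⟩
  have hKI₀ : K ≤ I₀ := by
    refine sInf_le_sInf ?_
    rintro _ ⟨⟨k, rfl⟩, hk⟩
    exact ⟨k, Fin.castSucc_lt_castSucc_iff.2 (horder _ _ hk), rfl⟩
  have hKJ : K ≤ J :=
    sInf_le_sInf (Set.image_mono fun k hk ↦ Fin.castSucc_lt_castSucc_iff.2 hk.1)
  have hLI : L ≤ I := by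
    refine sInf_le_sInf ?_
    rintro _ ⟨⟨k, rfl⟩, hk⟩
    refine ⟨k, Fin.castSucc_lt_succ_iff.2 ?_, rfl⟩
    rcases hk.eq_or_lt with h | h
    · exact (hp h).ge
    · exact (horder _ _ h).le
  have hIJL : I ⊓ J ≤ L := by
    refine le_sInf ?_
    rintro _ ⟨k, hk, rfl⟩
    by_cases hik : p i ≤ p k
    · exact inf_le_left.trans (sInf_le ⟨⟨k, rfl⟩, hik⟩)
    · have hne : k ≠ i := fun h ↦ hik (h ▸ le_rfl)
      exact inf_le_right.trans
        (sInf_le ⟨k, ⟨lt_of_le_of_ne (Fin.castSucc_lt_succ_iff.1 hk) hne, hik⟩, rfl⟩)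
  have hI₀JK : I₀ ⊓ J ≤ K := by
    refine le_sInf ?_
    rintro _ ⟨k, hk, rfl⟩
    have hki : k < i := Fin.castSucc_lt_castSucc_iff.1 hk
    by_cases hik : p i ≤ p k
    · exact inf_le_left.trans (sInf_le ⟨⟨k, rfl⟩, lt_of_le_of_ne hik (hp.ne hki.ne')⟩)
    · exact inf_le_right.trans (sInf_le ⟨k, ⟨hki, hik⟩, rfl⟩)
  have hI₀eq : I ⊔ K = I₀ := by
    refine le_antisymm (sup_le hII₀ hKI₀) fun c hc ↦ ?_
    obtain ⟨a, ha, b, hb, hab⟩ := Submodule.mem_sup.1 (hIJ ▸ mem_top : (1 : A) ∈ I ⊔ J)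
    rw [← mul_one c, ← hab, mul_add]
    exact Submodule.add_mem_sup (I.mul_mem_left c ha)
      (hI₀JK ⟨I₀.mul_mem_right b hc, J.mul_mem_left c hb⟩)
  have hinf : nilTorsion M I ⊓ F i.castSucc = nilTorsion M I₀ := by
    rw [hlow, ← nilTorsion_sup, hI₀eq]
  have hsup : nilTorsion M I ⊔ F i.castSucc = F i.succ := by
    refine le_antisymm (sup_le (hhigh ▸ nilTorsion_anti hLI)
      (hF.2.2.1 Fin.castSucc_lt_succ.le)) ?_
    rw [hhigh, hlow]
    exact (nilTorsion_anti hIJL).trans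
      ((nilTorsion_inf_le_sup hIJ).trans (sup_le_sup_left (nilTorsion_anti hKJ) _))
  have e := LinearMap.quotientInfEquivSupQuotient (nilTorsion M I) (F i.castSucc)
  rw [← comap_inf, hinf, hsup] at e
  exact ⟨e.symm⟩

end IsCoprimaryFiltration

/-- Let `A` be a commutative Noetherian ring and `M` a nonzero finitely
generated `A`-module such that any two incomparable associated primes of `M` are comaximal.
Then any two coprimary filtrations of `M` are equivalent: subquotients associated to the
same prime are isomorphic. -/
theorem coprimary_filtrations_equivalent
    {A : Type*} [CommRing A] [IsNoetherianRing A]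
    {M : Type*} [AddCommGroup M] [Module A M] [Module.Finite A M] [Nontrivial M]
    (hcomax : ∀ p q : Ideal A, p ∈ associatedPrimes A M → q ∈ associatedPrimes A M →
      ¬ p ≤ q → ¬ q ≤ p → p ⊔ q = ⊤)
    {n : ℕ} (p q : Fin n → Ideal A)
    (hpinj : Function.Injective p) (hpAss : associatedPrimes A M = Set.range p)
    (hporder : ∀ a b, p a < p b → b < a)
    (hqinj : Function.Injective q) (hqAss : associatedPrimes A M = Set.range q)
    (hqorder : ∀ a b, q a < q b → b < a)
    (F G : Fin (n + 1) → Submodule A M)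
    (hF : IsCoprimaryFiltration p F) (hG : IsCoprimaryFiltration q G)
    (i j : Fin n) (hij : p i = q j) :
    Nonempty ((↥(F i.succ) ⧸ Submodule.comap (F i.succ).subtype (F i.castSucc)) ≃ₗ[A]
      (↥(G j.succ) ⧸ Submodule.comap (G j.succ).subtype (G j.castSucc))) := by
  have hcomax' : ∀ {r : Fin n → Ideal A}, associatedPrimes A M = Set.range r →
      ∀ a b, ¬ r a ≤ r b → ¬ r b ≤ r a → r a ⊔ r b = ⊤ := fun hr a b ↦
    hcomax _ _ (hr ▸ Set.mem_range_self a) (hr ▸ Set.mem_range_self b)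
  obtain ⟨e⟩ := hF.nonempty_subquotient_equiv hpinj hporder (hcomax' hpAss) i
  obtain ⟨e'⟩ := hG.nonempty_subquotient_equiv hqinj hqorder (hcomax' hqAss) j
  rw [← hqAss, ← hij, hpAss] at e'
  exact ⟨e.trans e'.symm⟩
end

section
/- Let A be a commutative Noetherian ring and M a nonzero finitely generated A-module with Ass(M) = {p_1, …, p_n}, the p_i pairwise distinct, and assume p_i + p_j = A for all i ≠ j (equivalently, no prime ideal of A contains both p_i and p_j for i ≠ j). For each i ∈ {1, …, n} set M_i = ⋂_{j ≠ i} ker(M → M_{p_j}), the intersection of the kernels of the canonical localization maps of M at the primes p_j with j ≠ i. Then Ass(M_i) = {p_i} for each i, and M is the internal direct sum of M_1, …, M_n: the family of submodules M_1, …, M_n is independent and M_1 + ⋯ + M_n = M. -/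
/-- A module element in the kernel of localization at every associated prime is zero. -/
theorem eq_zero_of_forall_associatedPrimes_exists_smul_eq_zero
    {A M : Type*} [CommRing A] [IsNoetherianRing A] [AddCommGroup M] [Module A M] {x : M}
    (h : ∀ q ∈ associatedPrimes A M, ∃ s ∉ q, s • x = 0) : x = 0 := by
  by_contra hx
  obtain ⟨q, hq, hle⟩ := exists_le_isAssociatedPrime_of_isNoetherianRing A x hx
  obtain ⟨s, hs, hsx⟩ := h q hq
  exact hs (hle (by simpa [Submodule.mem_colon_singleton] using hsx))

/-- If finitely many ideals include all associated primes of a finite module over a Noetherian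
ring, then a power of their product annihilates the module. -/
theorem exists_prod_pow_le_annihilator
    {A M ι : Type*} [CommRing A] [IsNoetherianRing A] [AddCommGroup M] [Module A M]
    [Module.Finite A M] [Fintype ι] {p : ι → Ideal A}
    (hp : associatedPrimes A M ⊆ Set.range p) :
    ∃ k, ∏ i, p i ^ k ≤ Module.annihilator A M := by
  obtain ⟨k, hk⟩ := Ideal.exists_radical_pow_le_of_fg (Module.annihilator A M)
    (IsNoetherian.noetherian _)
  refine ⟨k, ?_⟩
  rw [Finset.prod_pow]
  refine (Ideal.pow_right_mono ?_ k).trans hk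
  rw [← Ideal.sInf_minimalPrimes]
  refine le_sInf fun q hq ↦ ?_
  obtain ⟨i, rfl⟩ := hp
    (Module.associatedPrimes.minimalPrimes_annihilator_subset_associatedPrimes A M hq)
  exact Ideal.prod_le_inf.trans (Finset.inf_le (Finset.mem_univ i))

/-- Let `A` be a commutative Noetherian ring and `M` a nonzero finitely
generated `A`-module with `Ass(M) = {p 0, …, p (n-1)}`, the `p i` pairwise distinct and
pairwise comaximal.  For each `i` set `Mᵢ = ⋂_{j ≠ i} ker (M → M_{p j})`.  Then
`Ass(Mᵢ) = {p i}` for each `i`, and `M` is the internal direct sum of the `Mᵢ`. -/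
theorem coprimary_direct_sum_decomposition
    {A : Type*} [CommRing A] [IsNoetherianRing A]
    {M : Type*} [AddCommGroup M] [Module A M] [Module.Finite A M] [Nontrivial M]
    {n : ℕ} (p : Fin n → Ideal A) (hprime : ∀ i, (p i).IsPrime)
    (hinj : Function.Injective p)
    (hAss : associatedPrimes A M = Set.range p)
    (hcomax : ∀ i j, i ≠ j → p i ⊔ p j = ⊤)
    (N : Fin n → Submodule A M)
    (hN : ∀ i, N i = ⨅ (j : Fin n) (_ : j ≠ i),
      LinearMap.ker (LocalizedModule.mkLinearMap
        (@Ideal.primeCompl A _ (p j) (hprime j)) M)) :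
    (∀ i, associatedPrimes A ↥(N i) = {p i}) ∧ iSupIndep N ∧ (⨆ i, N i) = ⊤ := by
  have mem_N {i : Fin n} {x : M} : x ∈ N i ↔ ∀ j ≠ i, ∃ s ∉ p j, s • x = 0 := by
    simp only [hN, Submodule.mem_iInf, LocalizedModule.mem_ker_mkLinearMap_iff]
    rfl
  have not_le {i j : Fin n} (hij : j ≠ i) : ¬ p i ≤ p j := fun h ↦
    (hprime j).ne_top (by rw [← hcomax j i hij, sup_eq_left.mpr h])
  refine ⟨fun i ↦ Set.eq_singleton_iff_unique_mem.mpr ⟨?_, fun q hq ↦ ?_⟩, ?_⟩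
  · have hi : p i ∈ associatedPrimes A M := hAss ▸ Set.mem_range_self i
    obtain ⟨-, x, hx⟩ := isAssociatedPrime_iff.mp hi
    have hxN : x ∈ N i := mem_N.mpr fun j hj ↦ by
      obtain ⟨s, hs, hsj⟩ := SetLike.not_le_iff_exists.mp (not_le hj)
      rw [hx] at hs
      exact ⟨s, hsj, by simpa [Submodule.mem_colon_singleton] using hs⟩
    refine isAssociatedPrime_iff.mpr ⟨hprime i, ⟨x, hxN⟩, ?_⟩
    rw [hx]
    ext a
    simp [Submodule.mem_colon_singleton]
  · obtain ⟨j, rfl⟩ : q ∈ Set.range p :=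
      hAss ▸ associatedPrimes.subset_of_injective (N i).injective_subtype hq
    obtain ⟨-, ⟨x, hxN⟩, hx⟩ := isAssociatedPrime_iff.mp hq
    by_contra hne
    obtain ⟨s, hs, hsx⟩ := mem_N.mp hxN j fun h ↦ hne (congrArg p h)
    refine hs ?_
    rw [hx]
    simpa [Submodule.mem_colon_singleton] using hsx
  · obtain ⟨k, hk⟩ := exists_prod_pow_le_annihilator hAss.subset
    have hpow : ((Finset.univ : Finset (Fin n)) : Set (Fin n)).Pairwise
        fun i j ↦ p i ^ k ⊔ p j ^ k = ⊤ :=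
      fun i _ j _ hij ↦ Ideal.pow_sup_pow_eq_top (hcomax i j hij)
    have N_eq : N = fun i ↦ Submodule.torsionBySet A M (p i ^ k : Ideal A) := by
      funext i
      ext x
      rw [Submodule.mem_torsionBySet_iff]
      refine ⟨fun hx ⟨a, ha⟩ ↦ ?_, fun hx ↦ mem_N.mpr fun j hj ↦ ?_⟩
      · refine eq_zero_of_forall_associatedPrimes_exists_smul_eq_zero (A := A) fun q hq ↦ ?_
        obtain ⟨j, rfl⟩ := hAss.subset hq
        by_cases hj : j = i
        · subst hj
          have hnot : ¬ ∏ l ∈ Finset.univ.erase j, p l ^ k ≤ p j := fun h ↦ by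
            obtain ⟨l, hl, hle⟩ := (hprime j).prod_le.mp h
            exact not_le (Finset.ne_of_mem_erase hl).symm ((hprime j).le_of_pow_le hle)
          obtain ⟨s, hs, hsj⟩ := SetLike.not_le_iff_exists.mp hnot
          refine ⟨s, hsj, ?_⟩
          rw [smul_smul]
          refine Module.mem_annihilator.mp (hk ?_) x
          rw [← Finset.prod_erase_mul _ _ (Finset.mem_univ j)]
          exact Ideal.mul_mem_mul hs ha
        · obtain ⟨s, hs, hsx⟩ := mem_N.mp hx j hj
          exact ⟨s, hs, by rw [smul_comm]; simp [hsx]⟩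
      · obtain ⟨s, hs, hsj⟩ := SetLike.not_le_iff_exists.mp
          fun h ↦ not_le hj ((hprime j).le_of_pow_le h)
        exact ⟨s, hsj, hx ⟨s, hs⟩⟩
    rw [N_eq]
    refine ⟨iSupIndep_iff_supIndep_univ.mpr (Submodule.supIndep_torsionBySet_ideal hpow), ?_⟩
    have hsup := Submodule.iSup_torsionBySet_ideal_eq_torsionBySet_iInf (M := M) hpow
    have hprod : ∏ i, p i ^ k = ⨅ i ∈ Finset.univ, p i ^ k :=
      Ideal.prod_eq_iInf_of_pairwise_isCoprime fun i hi j hj hij ↦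
        Ideal.isCoprime_iff_sup_eq.mpr (hpow hi hj hij)
    simp only [Finset.mem_univ, iSup_pos] at hsup
    rw [hsup, eq_top_iff]
    intro x _
    rw [Submodule.mem_torsionBySet_iff]
    rintro ⟨a, ha⟩
    refine Module.mem_annihilator.mp (hk ?_) x
    rw [hprod]
    simpa using ha
end
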